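/- Let M be a module and suppose there exists a function ξ from direct summands of M to ℕ such that ξ(A ⊕ B) = ξ(A) + ξ(B) whenever A, B are independent direct summands of M with A ⊕ B a direct summand of M, and ξ(N) ≠ 0 for every nonzero direct summand N. Then M has finite Krull-Schmidt length and KSℓ(N) ≤ ξ(N) for every direct summand N of M. -/

import Mathlib

/-- `N` is a direct summand of the module `M`. -/
def IsSummand {R : Type*} [Ring R] {M : Type*} [AddCommGroup M] [Module R M]
    (N : Submodule R M) : Prop :=
  ∃ N', IsCompl N N'

/-- `s` is a direct sum decomposition of the submodule `N` into nonzero summands. -/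
def IsDecompOf {R : Type*} [Ring R] {M : Type*} [AddCommGroup M] [Module R M]
    (N : Submodule R M) (s : Set (Submodule R M)) : Prop :=
  sSupIndep s ∧ sSup s = N ∧ ⊥ ∉ s

theorem IsSummand.left_aux {R : Type*} [Ring R] {M : Type*} [AddCommGroup M] [Module R M]
    {A B : Submodule R M} (hAB : Disjoint A B) (h : IsSummand (A ⊔ B)) : IsSummand A := by
  obtain ⟨C, hC⟩ := h
  refine ⟨B ⊔ C, ?_, ?_⟩
  · exact Disjoint.disjoint_sup_right_of_disjoint_sup_left hAB hC.disjoint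
  · rw [codisjoint_iff, ← sup_assoc]
    exact hC.sup_eq_top

theorem card_le_aux {R : Type*} [Ring R] {M : Type*} [AddCommGroup M]
    [Module R M] (ξ : Submodule R M → ℕ)
    (hadd : ∀ A B : Submodule R M, IsSummand A → IsSummand B → A ⊓ B = ⊥ →
      IsSummand (A ⊔ B) → ξ (A ⊔ B) = ξ A + ξ B)
    (hne : ∀ N : Submodule R M, IsSummand N → N ≠ ⊥ → ξ N ≠ 0)
    (t : Finset (Submodule R M)) : ∀ N : Submodule R M, IsSummand N →
      ∀ s : Set (Submodule R M), IsDecompOf N s → (t : Set (Submodule R M)) ⊆ s →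
        t.card ≤ ξ N := by
  classical
  induction t using Finset.induction_on with
  | empty => intros; simp
  | insert a t ha ih =>
    intro N hN s hs hts
    obtain ⟨hi, hsup, hb⟩ := hs
    have has : a ∈ s := hts (by simp)
    have hd : Disjoint a (sSup (s \ {a})) := hi has
    have hN' : a ⊔ sSup (s \ {a}) = N := by
      rw [← sSup_insert, Set.insert_diff_singleton, Set.insert_eq_of_mem has, hsup]
    rw [← hN'] at hN
    have hA : IsSummand a := hN.left_aux hd
    have hB : IsSummand (sSup (s \ {a})) := by
      rw [sup_comm] at hN
      exact hN.left_aux hd.symm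
    have h1 := hadd _ _ hA hB hd.eq_bot hN
    have h2 := hne a hA (fun h => hb (h ▸ has))
    have h3 := ih _ hB (s \ {a}) ⟨hi.mono Set.diff_subset, rfl, fun h => hb h.1⟩
      (fun x hx => ⟨hts (by simp [Finset.mem_coe.1 hx]), fun h => ha (by
        rw [Set.mem_singleton_iff] at h; subst h; exact hx)⟩)
    rw [Finset.card_insert_of_notMem ha, ← hN', h1]
    omega

/-- If there is a function `ξ` on direct summands of `M` with values in `ℕ` that is
additive on direct sums of independent summands and nonzero on nonzero summands, then `M`
has finite Krull-Schmidt length; indeed every direct sum decomposition of a direct summand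
`N` into nonzero summands is finite of cardinality at most `ξ N`. -/
theorem KS_length_le_of_additive_function {R : Type*} [Ring R] {M : Type*} [AddCommGroup M]
    [Module R M] (ξ : Submodule R M → ℕ)
    (hadd : ∀ A B : Submodule R M, IsSummand A → IsSummand B → A ⊓ B = ⊥ →
      IsSummand (A ⊔ B) → ξ (A ⊔ B) = ξ A + ξ B)
    (hne : ∀ N : Submodule R M, IsSummand N → N ≠ ⊥ → ξ N ≠ 0) :
    (∃ n : ℕ, ∀ s : Set (Submodule R M), IsDecompOf ⊤ s → s.Finite ∧ s.ncard ≤ n) ∧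
    ∀ N : Submodule R M, IsSummand N →
      ∀ s : Set (Submodule R M), IsDecompOf N s → s.Finite ∧ s.ncard ≤ ξ N := by
  have key : ∀ N : Submodule R M, IsSummand N →
      ∀ s : Set (Submodule R M), IsDecompOf N s → s.Finite ∧ s.ncard ≤ ξ N := by
    intro N hN s hs
    have hfin : s.Finite := by
      by_contra hinf
      obtain ⟨t, hts, htc⟩ := Set.Infinite.exists_subset_card_eq hinf (ξ N + 1)
      have := card_le_aux ξ hadd hne t N hN s hs hts
      omega
    refine ⟨hfin, ?_⟩
    rw [Set.ncard_eq_toFinset_card s hfin]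
    exact card_le_aux ξ hadd hne _ N hN s hs (by simp)
  exact ⟨⟨ξ ⊤, key ⊤ ⟨⊥, isCompl_top_bot⟩⟩, key⟩
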